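/- arXiv:2506.04602 — 2 statements merged into one kernel-verified Lean document; each statement's English description precedes it below -/
import Mathlib

section
/- Efficiency of feature-level Shapley values: for every utility function v : Finset (Fin n) → ℝ (with n ≥ 1), the sum of the Shapley values of all features equals the value of the grand coalition minus the value of the empty coalition, i.e. Σ_{i ∈ Fin n} φ_i(v) = v(univ) − v(∅). -/
open Finset

/-- The feature-level Shapley value of feature `i` for utility function `v`:
`φ_i(v) = (1/n) · Σ_{S ⊆ N \ {i}} (C(n-1, |S|))⁻¹ · (v (S ∪ {i}) - v S)`. -/
noncomputable def shapley {n : ℕ} (v : Finset (Fin n) → ℝ) (i : Fin n) : ℝ :=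
  (1 / (n : ℝ)) * ∑ S ∈ ((univ : Finset (Fin n)) \ {i}).powerset,
    (((n - 1).choose S.card : ℝ))⁻¹ * (v (S ∪ {i}) - v S)

/-- Reindexing along `S ↦ S ∪ {i}`, from the sets avoiding `i` to the sets containing `i`. -/
lemma sum_powerset_sdiff_singleton_union {α : Type*} [Fintype α] [DecidableEq α]
    (c : ℕ → ℝ) (v : Finset α → ℝ) (i : α) :
    ∑ S ∈ ((univ : Finset α) \ {i}).powerset, c S.card * v (S ∪ {i}) =
      ∑ T : Finset α, if i ∈ T then c (T.card - 1) * v T else 0 := by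
  rw [← sum_filter]
  have notMem : ∀ S ∈ ((univ : Finset α) \ {i}).powerset, i ∉ S := fun S hS hi => by
    simpa using mem_powerset.1 hS hi
  refine sum_nbij' (fun S => insert i S) (fun T => T.erase i) ?_ ?_ ?_ ?_ ?_
  · intro S _
    simp
  · intro T _
    rw [mem_powerset]
    intro x hx
    simpa using ne_of_mem_erase hx
  · intro S hS
    exact erase_insert (notMem S hS)
  · intro T hT
    exact insert_erase (mem_filter.1 hT).2
  · intro S hS
    rw [card_insert_of_notMem (notMem S hS), union_comm, ← insert_eq, Nat.add_sub_cancel]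

lemma sum_powerset_sdiff_singleton {α : Type*} [Fintype α] [DecidableEq α]
    (f : Finset α → ℝ) (i : α) :
    ∑ S ∈ ((univ : Finset α) \ {i}).powerset, f S =
      ∑ T : Finset α, if i ∉ T then f T else 0 := by
  have h : ((univ : Finset α) \ {i}).powerset = univ.filter (fun T => i ∉ T) := by
    ext T
    simp [subset_sdiff]
  rw [h, sum_filter]

/-- The net weight with which a coalition of size `t` enters the sum of all Shapley values. -/
lemma mul_inv_choose_sub_mul_inv_choose (m t : ℕ) (ht : t ≤ m + 1) :
    (t : ℝ) * (m.choose (t - 1) : ℝ)⁻¹ - ((m : ℝ) + 1 - t) * (m.choose t : ℝ)⁻¹ =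
      (if t = m + 1 then (m : ℝ) + 1 else 0) - (if t = 0 then (m : ℝ) + 1 else 0) := by
  rcases t with _ | s
  · simp
  · rcases (Nat.succ_le_succ_iff.1 ht).eq_or_lt with rfl | hs
    · simp
    · have h : (m.choose (s + 1) : ℝ) * (s + 1) = m.choose s * ((m : ℝ) - s) := by
        rw [← Nat.cast_sub hs.le]
        exact_mod_cast Nat.choose_succ_right_eq m s
      have h₀ : (m.choose s : ℝ) ≠ 0 := by exact_mod_cast (Nat.choose_pos hs.le).ne'
      have h₁ : (m.choose (s + 1) : ℝ) ≠ 0 := by exact_mod_cast (Nat.choose_pos hs).ne'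
      rw [if_neg (by omega), if_neg (by omega), Nat.add_sub_cancel]
      push_cast
      field_simp
      linear_combination h

/-- Efficiency: the Shapley values of all features sum to `v univ - v ∅`. -/
theorem shapley_efficiency {n : ℕ} (hn : 1 ≤ n) (v : Finset (Fin n) → ℝ) :
    ∑ i : Fin n, shapley v i = v univ - v ∅ := by
  obtain ⟨m, rfl⟩ := Nat.exists_eq_add_of_le' hn
  have weight : ∀ T : Finset (Fin (m + 1)),
      ∑ i, ((if i ∈ T then (m.choose (T.card - 1) : ℝ)⁻¹ * v T else 0) -
        (if i ∉ T then (m.choose T.card : ℝ)⁻¹ * v T else 0)) =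
      (if T = univ then ((m : ℝ) + 1) * v T else 0) -
        (if T = ∅ then ((m : ℝ) + 1) * v T else 0) := by
    intro T
    have hT : T.card ≤ m + 1 := by simpa using card_le_univ T
    have hc : ((univ.filter (fun i => i ∉ T)).card : ℝ) = (m : ℝ) + 1 - T.card := by
      rw [filter_not, filter_mem_eq_inter, univ_inter, ← compl_eq_univ_sdiff, card_compl,
        Fintype.card_fin, Nat.cast_sub hT]
      push_cast
      ring
    have key := mul_inv_choose_sub_mul_inv_choose m T.card hT
    have hu : T.card = m + 1 ↔ T = univ := by
      rw [← card_eq_iff_eq_univ, Fintype.card_fin]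
    simp only [hu, card_eq_zero] at key
    rw [sum_sub_distrib, ← sum_filter, ← sum_filter, sum_const, sum_const, nsmul_eq_mul,
      nsmul_eq_mul, hc, filter_mem_eq_inter, univ_inter]
    rw [← ite_zero_mul, ← ite_zero_mul]
    linear_combination v T * key
  simp only [shapley, Nat.add_sub_cancel, mul_sub, sum_sub_distrib]
  simp only [sum_powerset_sdiff_singleton_union (fun k => (m.choose k : ℝ)⁻¹),
    sum_powerset_sdiff_singleton (fun S => (m.choose S.card : ℝ)⁻¹ * v S)]
  simp only [← mul_sub, ← mul_sum, ← sum_sub_distrib]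
  rw [sum_comm, sum_congr rfl (fun T _ => weight T), sum_sub_distrib,
    sum_ite_eq' univ univ, sum_ite_eq' univ ∅]
  have hm : (m : ℝ) + 1 ≠ 0 := by positivity
  simp only [mem_univ, if_true]
  push_cast
  field_simp
end

section
/- Uniqueness theorem for the Shapley attribution: fix n ≥ 1 and let ψ be a map assigning to every utility function v : Finset (Fin n) → ℝ a vector ψ(v) : Fin n → ℝ satisfying: (Efficiency) Σ_{i ∈ Fin n} ψ_i(v) = v(univ) − v(∅) for every v; (Symmetry) whenever i ≠ j and v(S ∪ {i}) = v(S ∪ {j}) for every S ⊆ Fin n with i ∉ S and j ∉ S, then ψ_i(v) = ψ_j(v); (Null player) whenever v(S ∪ {i}) = v(S) for every S ⊆ Fin n with i ∉ S, then ψ_i(v) = 0; (Additivity) ψ_i(v + w) = ψ_i(v) + ψ_i(w) for all v, w and all i, where (v + w)(S) = v(S) + w(S). Then ψ coincides with the Shapley value: ψ_i(v) = φ_i(v) for every utility function v and every feature i. -/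
open Finset

/-- The unanimity game of the coalition `T`, scaled by `c`. -/
def unanimityGame {α : Type*} [DecidableEq α] (c : ℝ) (T : Finset α) : Finset α → ℝ :=
  fun S => if T ⊆ S then c else 0

/-- An additive map on games that vanishes on all scaled unanimity games is zero. -/
theorem addMonoidHom_eq_zero_of_unanimityGame {α M : Type*} [Fintype α] [DecidableEq α]
    [AddCommGroup M] (A : (Finset α → ℝ) →+ M)
    (h : ∀ c T, A (unanimityGame c T) = 0) : A = 0 := by
  have single : ∀ (T : Finset α) (c : ℝ), A (Pi.single T c) = 0 := by
    intro T
    induction T using (wellFounded_gt (α := Finset α)).induction with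
    | _ T ih =>
      intro c
      have decomposition : unanimityGame c T =
          Pi.single T c + ∑ S ∈ univ.filter (T ⊂ ·), Pi.single S c := by
        funext S
        simp only [unanimityGame, Pi.add_apply, Finset.sum_apply, Pi.single_apply,
          Finset.sum_ite_eq, mem_filter, mem_univ, true_and]
        by_cases hST : S = T
        · simp [hST]
        · simp [hST, ssubset_iff_subset_ne, Ne.symm hST]
      have hT := h c T
      rw [decomposition, map_add, map_sum, Finset.sum_eq_zero, add_zero] at hT
      · exact hT
      · intro S hS
        exact ih S (mem_filter.mp hS).2 c
  refine AddMonoidHom.ext fun v => ?_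
  rw [← Finset.univ_sum_single v, map_sum, Finset.sum_eq_zero (fun T _ => single T (v T))]
  rfl

/-- An additive, symmetric attribution with the null player property whose total attribution is
always zero vanishes. -/
theorem attribution_eq_zero {α : Type*} [Fintype α] [DecidableEq α]
    (A : (Finset α → ℝ) →+ (α → ℝ)) (hsum : ∀ v, ∑ i, A v i = 0)
    (hsymm : ∀ (v : Finset α → ℝ) (i j : α), i ≠ j →
      (∀ S : Finset α, i ∉ S → j ∉ S → v (S ∪ {i}) = v (S ∪ {j})) → A v i = A v j)
    (hnull : ∀ (v : Finset α → ℝ) (i : α),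
      (∀ S : Finset α, i ∉ S → v (S ∪ {i}) = v S) → A v i = 0) : A = 0 := by
  refine addMonoidHom_eq_zero_of_unanimityGame A fun c T => ?_
  have outside : ∀ i ∉ T, A (unanimityGame c T) i = 0 := by
    refine fun i hi => hnull _ i fun S _ => ?_
    have : T ⊆ S ∪ {i} ↔ T ⊆ S := by
      rw [union_comm, ← insert_eq, subset_insert_iff_of_notMem hi]
    simp only [unanimityGame, this]
  have inside : ∀ i ∈ T, ∀ j ∈ T, A (unanimityGame c T) i = A (unanimityGame c T) j := by
    intro i hi j hj
    by_cases hij : i = j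
    · rw [hij]
    refine hsymm _ i j hij fun S hiS hjS => ?_
    have hi' : ¬ T ⊆ S ∪ {j} := fun hT => by simpa [hiS, hij] using hT hi
    have hj' : ¬ T ⊆ S ∪ {i} := fun hT => by simpa [hjS, Ne.symm hij] using hT hj
    simp only [unanimityGame, hi', hj']
  funext i
  by_cases hi : i ∈ T
  · have total := hsum (unanimityGame c T)
    rw [← Finset.sum_subset (subset_univ T) (fun j _ hj => outside j hj),
      Finset.sum_congr rfl (fun j hj => inside j hj i hi), sum_const, nsmul_eq_mul] at total
    have : (T.card : ℝ) ≠ 0 := Nat.cast_ne_zero.mpr (card_ne_zero_of_mem hi)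
    exact (mul_eq_zero.mp total).resolve_left this
  · exact outside i hi

theorem shapley_add {n : ℕ} (v w : Finset (Fin n) → ℝ) (i : Fin n) :
    shapley (v + w) i = shapley v i + shapley w i := by
  simp only [shapley, ← mul_add, ← Finset.sum_add_distrib, Pi.add_apply]
  congr 1
  exact Finset.sum_congr rfl fun S _ => by ring

theorem shapley_eq_zero_of_null {n : ℕ} (v : Finset (Fin n) → ℝ) (i : Fin n)
    (h : ∀ S : Finset (Fin n), i ∉ S → v (S ∪ {i}) = v S) : shapley v i = 0 := by
  rw [shapley, Finset.sum_eq_zero, mul_zero]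
  intro S hS
  have hi : i ∉ S := fun hi => by simpa using mem_powerset.mp hS hi
  rw [h S hi, sub_self, mul_zero]

/-- A game in which `i` and `j` are interchangeable is invariant under swapping them. -/
theorem apply_image_swap {α : Type*} [DecidableEq α] (v : Finset α → ℝ) {i j : α}
    (h : ∀ S : Finset α, i ∉ S → j ∉ S → v (S ∪ {i}) = v (S ∪ {j})) (T : Finset α) :
    v (T.image (Equiv.swap i j)) = v T := by
  by_cases hij : i = j
  · subst hij
    simp
  have mem_image_swap (x : α) : x ∈ T.image (Equiv.swap i j) ↔ Equiv.swap i j x ∈ T := by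
    rw [mem_image]
    exact ⟨by rintro ⟨y, hy, rfl⟩; simpa using hy, fun hx => ⟨_, hx, by simp⟩⟩
  by_cases hi : i ∈ T <;> by_cases hj : j ∈ T
  · congr 1
    ext x
    rw [mem_image_swap, Equiv.swap_apply_def]
    split_ifs <;> simp_all
  · have hT : T = T.erase i ∪ {i} := by grind
    have hT' : T.image (Equiv.swap i j) = T.erase i ∪ {j} := by
      ext x
      rw [mem_image_swap, Equiv.swap_apply_def]
      grind
    rw [hT', ← h _ (by simp) (by simp [hj]), ← hT]
  · have hT : T = T.erase j ∪ {j} := by grind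
    have hT' : T.image (Equiv.swap i j) = T.erase j ∪ {i} := by
      ext x
      rw [mem_image_swap, Equiv.swap_apply_def]
      grind
    rw [hT', h _ (by simp [hi]) (by simp), ← hT]
  · congr 1
    ext x
    rw [mem_image_swap, Equiv.swap_apply_def]
    split_ifs <;> simp_all

theorem shapley_eq_of_interchangeable {n : ℕ} (v : Finset (Fin n) → ℝ) (i j : Fin n)
    (h : ∀ S : Finset (Fin n), i ∉ S → j ∉ S → v (S ∪ {i}) = v (S ∪ {j})) :
    shapley v i = shapley v j := by
  unfold shapley
  congr 1
  refine Finset.sum_nbij' (fun S => S.image (Equiv.swap i j))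
    (fun S => S.image (Equiv.swap i j)) ?_ ?_ ?_ ?_ ?_
  · intro S hS
    simp only [mem_powerset, subset_sdiff, subset_univ, true_and, disjoint_singleton_right,
      mem_image, not_exists, not_and] at hS ⊢
    intro x hx hxj
    rw [Equiv.swap_apply_eq_iff, Equiv.swap_apply_right] at hxj
    exact hS (hxj ▸ hx)
  · intro S hS
    simp only [mem_powerset, subset_sdiff, subset_univ, true_and, disjoint_singleton_right,
      mem_image, not_exists, not_and] at hS ⊢
    intro x hx hxi
    rw [Equiv.swap_apply_eq_iff, Equiv.swap_apply_left] at hxi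
    exact hS (hxi ▸ hx)
  · intro S _
    simp [image_image, Function.comp_def]
  · intro S _
    simp [image_image, Function.comp_def]
  · intro S _
    have union_image : S.image (Equiv.swap i j) ∪ {j} = (S ∪ {i}).image (Equiv.swap i j) := by
      simp
    rw [union_image, apply_image_swap v h, apply_image_swap v h,
      card_image_of_injective _ (Equiv.injective _)]

/-- The marginal contributions of `i`, grouped by the coalitions containing `i` and those
avoiding it. -/
theorem shapley_eq_sum_ite {n : ℕ} (v : Finset (Fin n) → ℝ) (i : Fin n) :
    shapley v i = (1 / (n : ℝ)) * ∑ T : Finset (Fin n),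
      (if i ∈ T then ((n - 1).choose (T.card - 1) : ℝ)⁻¹ * v T
        else -(((n - 1).choose T.card : ℝ)⁻¹ * v T)) := by
  have avoiding : ((univ : Finset (Fin n)) \ {i}).powerset = univ.filter (i ∉ ·) := by
    ext S
    simp [subset_sdiff]
  rw [shapley, avoiding, Finset.sum_ite, Finset.sum_neg_distrib, ← sub_eq_add_neg]
  simp only [mul_sub, Finset.sum_sub_distrib]
  congr 2
  refine Finset.sum_nbij' (fun S => S ∪ {i}) (fun T => T.erase i) ?_ ?_ ?_ ?_ ?_
  · simp
  · simp
  · intro S hS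
    have := (mem_filter.mp hS).2
    grind
  · intro T hT
    have := (mem_filter.mp hT).2
    grind
  · intro S hS
    have hi : i ∉ S := (mem_filter.mp hS).2
    rw [card_union_of_disjoint (disjoint_singleton_right.mpr hi), card_singleton,
      Nat.add_sub_cancel]

/-- The total weight of a coalition of size `t` in the sum of all Shapley values. -/
theorem shapley_total_weight {n t : ℕ} (hn : 1 ≤ n) (ht : t ≤ n) :
    (t : ℝ) * ((n - 1).choose (t - 1) : ℝ)⁻¹ - ((n : ℝ) - t) * ((n - 1).choose t : ℝ)⁻¹ =
      (if t = n then (n : ℝ) else 0) - (if t = 0 then (n : ℝ) else 0) := by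
  obtain ⟨m, rfl⟩ : ∃ m, n = m + 1 := ⟨n - 1, by omega⟩
  rcases t with _ | s
  · simp
  rcases ht.eq_or_lt with hs | hs
  · obtain rfl : s = m := by omega
    simp
  · have hsm : s + 1 ≤ m := by omega
    have hne : s ≠ m := by omega
    have pos : (m.choose s : ℝ) ≠ 0 := Nat.cast_ne_zero.mpr (Nat.choose_pos (by omega)).ne'
    have pos_succ : (m.choose (s + 1) : ℝ) ≠ 0 :=
      Nat.cast_ne_zero.mpr (Nat.choose_pos hsm).ne'
    have recurrence : (m.choose (s + 1) : ℝ) * (s + 1) = m.choose s * ((m : ℝ) - s) := by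
      have := Nat.choose_succ_right_eq m s
      rw [← Nat.cast_sub (by omega : s ≤ m)]
      exact_mod_cast this
    simp only [Nat.add_sub_cancel, Nat.add_right_cancel_iff, hne, if_false,
      Nat.succ_ne_zero, sub_zero]
    push_cast
    field_simp
    linarith

theorem sum_shapley {n : ℕ} (hn : 1 ≤ n) (v : Finset (Fin n) → ℝ) :
    ∑ i, shapley v i = v univ - v ∅ := by
  have hn0 : (n : ℝ) ≠ 0 := Nat.cast_ne_zero.mpr (by omega)
  have coalition (T : Finset (Fin n)) :
      ∑ i, (if i ∈ T then ((n - 1).choose (T.card - 1) : ℝ)⁻¹ * v T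
        else -(((n - 1).choose T.card : ℝ)⁻¹ * v T)) =
      (if T = univ then n * v T else 0) - (if T = ∅ then n * v T else 0) := by
    have hT : T.card ≤ n := by simpa using card_le_univ T
    have weight := shapley_total_weight hn hT
    have full : T.card = n ↔ T = univ := by
      rw [← card_eq_iff_eq_univ, Fintype.card_fin]
    have complement : (univ.filter (· ∉ T)).card = n - T.card := by
      rw [filter_not, filter_mem_eq_inter, univ_inter, ← compl_eq_univ_sdiff, card_compl,
        Fintype.card_fin]
    simp only [full, card_eq_zero] at weight
    rw [Finset.sum_ite, sum_const, sum_const, complement, filter_mem_eq_inter, univ_inter,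
      nsmul_eq_mul, nsmul_eq_mul, Nat.cast_sub hT]
    calc _ = ((T.card : ℝ) * ((n - 1).choose (T.card - 1) : ℝ)⁻¹ -
          ((n : ℝ) - T.card) * ((n - 1).choose T.card : ℝ)⁻¹) * v T := by ring
      _ = _ := by rw [weight, sub_mul, ite_mul, ite_mul, zero_mul]
  simp only [shapley_eq_sum_ite]
  rw [← Finset.mul_sum, Finset.sum_comm]
  simp only [coalition, Finset.sum_sub_distrib, Finset.sum_ite_eq', mem_univ, if_true]
  field_simp

/-- Uniqueness: any attribution method `ψ` satisfying Efficiency, Symmetry, Null player,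
and Additivity coincides with the Shapley value. -/
theorem shapley_uniqueness {n : ℕ} (hn : 1 ≤ n)
    (ψ : (Finset (Fin n) → ℝ) → Fin n → ℝ)
    (hEff : ∀ v : Finset (Fin n) → ℝ, ∑ i : Fin n, ψ v i = v univ - v ∅)
    (hSym : ∀ (v : Finset (Fin n) → ℝ) (i j : Fin n), i ≠ j →
      (∀ S : Finset (Fin n), i ∉ S → j ∉ S → v (S ∪ {i}) = v (S ∪ {j})) →
      ψ v i = ψ v j)
    (hNull : ∀ (v : Finset (Fin n) → ℝ) (i : Fin n),
      (∀ S : Finset (Fin n), i ∉ S → v (S ∪ {i}) = v S) → ψ v i = 0)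
    (hAdd : ∀ (v w : Finset (Fin n) → ℝ) (i : Fin n),
      ψ (fun S => v S + w S) i = ψ v i + ψ w i) :
    ∀ (v : Finset (Fin n) → ℝ) (i : Fin n), ψ v i = shapley v i := by
  let A : (Finset (Fin n) → ℝ) →+ (Fin n → ℝ) := AddMonoidHom.mk'
    (fun v i => ψ v i - shapley v i) fun v w => by
      funext i
      have hψ : ψ (v + w) i = ψ v i + ψ w i := hAdd v w i
      simp only [Pi.add_apply, hψ, shapley_add]
      ring
  have hA : A = 0 := by
    refine attribution_eq_zero A (fun v => ?_) (fun v i j hij h => ?_) (fun v i h => ?_)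
    · change ∑ i, (ψ v i - shapley v i) = 0
      rw [Finset.sum_sub_distrib, hEff, sum_shapley hn, sub_self]
    · change ψ v i - shapley v i = ψ v j - shapley v j
      rw [hSym v i j hij h, shapley_eq_of_interchangeable v i j h]
    · change ψ v i - shapley v i = 0
      rw [hNull v i h, shapley_eq_zero_of_null v i h, sub_self]
  intro v i
  exact sub_eq_zero.mp (congrFun (DFunLike.congr_fun hA v) i)
end
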